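/- For the Softmax-attention Transformer loss on a single sample X_i, the gradient with respect to the collected key weights satisfies ‖∇_{W^K} f(M; X_i)‖_F ≤ K_i ‖MH(M; X_i) − y_i‖₂, where K_i = n √H ‖X_i‖_F³ ‖W^O‖₂ √(Σ_{h=1}^H σ_max²(W^Q_h)) · σ_max(W^V). -/

import Mathlib

open scoped BigOperators
open scoped Matrix

noncomputable section

namespace Paper

/-- Euclidean (`ℓ²`) norm of a finite family of reals. -/
def enorm {ι : Type*} [Fintype ι] (v : ι → ℝ) : ℝ := Real.sqrt (∑ i, v i ^ 2)

/-- Frobenius norm of a real matrix. -/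
def frob {m k : Type*} [Fintype m] [Fintype k] (A : Matrix m k ℝ) : ℝ :=
  Real.sqrt (∑ i, ∑ j, A i j ^ 2)

/-- Largest singular value of a real matrix: `sup` of `‖A v‖₂` over unit vectors `v`. -/
def sigmaMax {m k : Type*} [Fintype m] [Fintype k] (A : Matrix m k ℝ) : ℝ :=
  sSup {c | ∃ v : k → ℝ, (∑ j, v j ^ 2) = 1 ∧ c = enorm (A.mulVec v)}

/-- Smallest singular value of a (full row rank) real matrix:
`inf` of `‖uᵀ A‖₂` over unit vectors `u`. -/
def sigmaMin {m k : Type*} [Fintype m] [Fintype k] (A : Matrix m k ℝ) : ℝ :=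
  sInf {c | ∃ u : m → ℝ, (∑ i, u i ^ 2) = 1 ∧ c = enorm (Matrix.vecMul u A)}

variable {N n D d H : ℕ}

/-- Attention logits `C = X W^Q (X W^K)ᵀ / √d`. -/
def attnC (WQ WK : Matrix (Fin D) (Fin d) ℝ) (Xi : Matrix (Fin n) (Fin D) ℝ) :
    Matrix (Fin n) (Fin n) ℝ :=
  (Real.sqrt (d : ℝ))⁻¹ • (Xi * WQ * (Xi * WK)ᵀ)

/-- Row-wise softmax of a square matrix. -/
def softmaxMat (Z : Matrix (Fin n) (Fin n) ℝ) : Matrix (Fin n) (Fin n) ℝ :=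
  Matrix.of fun k j => Real.exp (Z k j) / ∑ l, Real.exp (Z k l)

/-- Softmax attention kernel. -/
def Ssoft (WQ WK : Matrix (Fin D) (Fin d) ℝ) (Xi : Matrix (Fin n) (Fin D) ℝ) :
    Matrix (Fin n) (Fin n) ℝ :=
  softmaxMat (attnC WQ WK Xi)

/-- Gaussian attention kernel. -/
def Sgauss (WQ WK : Matrix (Fin D) (Fin d) ℝ) (Xi : Matrix (Fin n) (Fin D) ℝ) :
    Matrix (Fin n) (Fin n) ℝ :=
  Matrix.of fun k j =>
    Real.exp (-(∑ l, (Matrix.vecMul (Xi k) WQ l - Matrix.vecMul (Xi j) WK l) ^ 2) /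
      (2 * Real.sqrt (d : ℝ)))

/-- Multi-head attention output on one sample, for given head kernels `S h`. -/
def MH (S : Fin H → Matrix (Fin n) (Fin n) ℝ) (WV : Fin H → Matrix (Fin D) (Fin d) ℝ)
    (WO : Fin H → Fin d → ℝ) (Xi : Matrix (Fin n) (Fin D) ℝ) : Fin n → ℝ :=
  fun k => ∑ h, ∑ l, (S h * Xi * WV h) k l * WO h l

/-- Squared-error loss `½ Σᵢ ‖out i − y i‖²`. -/
def lossOf (out y : Fin N → Fin n → ℝ) : ℝ :=
  (1 / 2) * ∑ i, ∑ k, (out i k - y i k) ^ 2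

/-- The stacked matrix `B ∈ ℝ^{Nn × HD}` whose `(i,h)` block is `S_{ih} X_i`. -/
def Bmat (S : Fin N → Fin H → Matrix (Fin n) (Fin n) ℝ)
    (X : Fin N → Matrix (Fin n) (Fin D) ℝ) :
    Matrix (Fin N × Fin n) (Fin H × Fin D) ℝ :=
  Matrix.of fun ik hp => (S ik.1 hp.1 * X ik.1) ik.2 hp.2

/-- Block-diagonal stacked value matrix `W^V = diag(W^V_1, …, W^V_H)`. -/
def diagWV (WV : Fin H → Matrix (Fin D) (Fin d) ℝ) :
    Matrix (Fin H × Fin D) (Fin H × Fin d) ℝ :=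
  Matrix.of fun hp hq => if hp.1 = hq.1 then WV hp.1 hp.2 hq.2 else 0

/-- Euclidean norm of the output weight `W^O ∈ ℝ^{Hd×1}`. -/
def WOnorm (WO : Fin H → Fin d → ℝ) : ℝ := enorm fun hl : Fin H × Fin d => WO hl.1 hl.2

/-- Frobenius norm of the row-stacked data matrix `X ∈ ℝ^{Nn×D}`. -/
def XF (X : Fin N → Matrix (Fin n) (Fin D) ℝ) : ℝ :=
  Real.sqrt (∑ i, ∑ k, ∑ p, X i k p ^ 2)

/-- The `h`-th head matrix of a packed head-indexed parameter vector. -/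
def headMat (v : EuclideanSpace ℝ (Fin H × Fin D × Fin d)) (h : Fin H) :
    Matrix (Fin D) (Fin d) ℝ :=
  Matrix.of fun p q => v (h, p, q)

/-- Index type for the full parameter set `M = (W^Q, W^K, W^V)`. -/
abbrev FullIdx (H D d : ℕ) := Fin 3 × Fin H × Fin D × Fin d

/-- Query weights of the packed full parameter vector. -/
def mQ (v : EuclideanSpace ℝ (FullIdx H D d)) (h : Fin H) : Matrix (Fin D) (Fin d) ℝ :=
  Matrix.of fun p q => v (0, h, p, q)

/-- Key weights of the packed full parameter vector. -/
def mK (v : EuclideanSpace ℝ (FullIdx H D d)) (h : Fin H) : Matrix (Fin D) (Fin d) ℝ :=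
  Matrix.of fun p q => v (1, h, p, q)

/-- Value weights of the packed full parameter vector. -/
def mV (v : EuclideanSpace ℝ (FullIdx H D d)) (h : Fin H) : Matrix (Fin D) (Fin d) ℝ :=
  Matrix.of fun p q => v (2, h, p, q)

/-- A packed `D × d` parameter vector as a matrix. -/
def toMat2 {D d : ℕ} (w : EuclideanSpace ℝ (Fin D × Fin d)) : Matrix (Fin D) (Fin d) ℝ :=
  Matrix.of fun p q => w (p, q)


lemma enorm_nonneg' {ι : Type*} [Fintype ι] (v : ι → ℝ) : 0 ≤ enorm v := Real.sqrt_nonneg _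

lemma enorm_sq' {ι : Type*} [Fintype ι] (v : ι → ℝ) : enorm v ^ 2 = ∑ i, v i ^ 2 :=
  Real.sq_sqrt (Finset.sum_nonneg fun _ _ => sq_nonneg _)

lemma frob_nonneg' {m k : Type*} [Fintype m] [Fintype k] (A : Matrix m k ℝ) : 0 ≤ frob A :=
  Real.sqrt_nonneg _

lemma frob_sq' {m k : Type*} [Fintype m] [Fintype k] (A : Matrix m k ℝ) :
    frob A ^ 2 = ∑ i, ∑ j, A i j ^ 2 :=
  Real.sq_sqrt (Finset.sum_nonneg fun _ _ => Finset.sum_nonneg fun _ _ => sq_nonneg _)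

lemma frob_transpose' {m k : Type*} [Fintype m] [Fintype k] (A : Matrix m k ℝ) :
    frob Aᵀ = frob A := by
  unfold frob
  rw [Finset.sum_comm]
  rfl

lemma enorm_mulVec_le_frob {m k : Type*} [Fintype m] [Fintype k] (A : Matrix m k ℝ)
    (v : k → ℝ) : enorm (A.mulVec v) ≤ frob A * enorm v := by
  refine le_of_sq_le_sq ?_ (mul_nonneg (frob_nonneg' A) (enorm_nonneg' v))
  rw [mul_pow, enorm_sq', enorm_sq', frob_sq', Finset.sum_mul]
  exact Finset.sum_le_sum fun i _ => Finset.sum_mul_sq_le_sq_mul_sq _ _ _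

lemma sigmaMax_nonneg' {m k : Type*} [Fintype m] [Fintype k] (A : Matrix m k ℝ) :
    0 ≤ sigmaMax A := by
  apply Real.sSup_nonneg
  rintro c ⟨v, _, rfl⟩
  exact enorm_nonneg' _

lemma enorm_smul' {ι : Type*} [Fintype ι] (c : ℝ) (v : ι → ℝ) :
    enorm (c • v) = |c| * enorm v := by
  unfold enorm
  simp only [Pi.smul_apply, smul_eq_mul, mul_pow]
  rw [← Finset.mul_sum, Real.sqrt_mul (sq_nonneg c), Real.sqrt_sq_eq_abs]

lemma enorm_mulVec_le_sigmaMax {m k : Type*} [Fintype m] [Fintype k] (A : Matrix m k ℝ)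
    (v : k → ℝ) : enorm (A.mulVec v) ≤ sigmaMax A * enorm v := by
  by_cases hv : enorm v = 0
  · have := enorm_mulVec_le_frob A v
    rw [hv] at this ⊢
    simpa using this
  · have hpos : 0 < enorm v := lt_of_le_of_ne (enorm_nonneg' v) (Ne.symm hv)
    have h1 : enorm ((enorm v)⁻¹ • v) = 1 := by
      rw [enorm_smul', abs_of_pos (inv_pos.mpr hpos), inv_mul_cancel₀ hv]
    have h2 : enorm (A.mulVec ((enorm v)⁻¹ • v)) ≤ sigmaMax A := by
      apply le_csSup
      · refine ⟨frob A, ?_⟩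
        rintro c ⟨w, hw, rfl⟩
        have := enorm_mulVec_le_frob A w
        rwa [show enorm w = 1 by unfold enorm; rw [hw, Real.sqrt_one], mul_one] at this
      · exact ⟨_, by rw [← enorm_sq', h1, one_pow], rfl⟩
    rw [Matrix.mulVec_smul, enorm_smul', abs_of_pos (inv_pos.mpr hpos),
      inv_mul_le_iff₀ hpos, mul_comm] at h2
    exact h2

lemma frob_mul_le_of {m k l : Type*} [Fintype m] [Fintype k] [Fintype l] (A : Matrix m k ℝ)
    (B : Matrix k l ℝ) (c : ℝ) (hc : 0 ≤ c)
    (h : ∀ v, enorm (A.mulVec v) ≤ c * enorm v) : frob (A * B) ≤ c * frob B := by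
  refine le_of_sq_le_sq ?_ (mul_nonneg hc (frob_nonneg' B))
  rw [mul_pow, frob_sq', frob_sq', Finset.sum_comm, Finset.sum_comm (f := fun i j => B i j ^ 2),
    Finset.mul_sum]
  refine Finset.sum_le_sum fun j _ => ?_
  have := pow_le_pow_left₀ (enorm_nonneg' _) (h (fun i => B i j)) 2
  rw [mul_pow, enorm_sq', enorm_sq'] at this
  exact this

lemma frob_mul_le {m k l : Type*} [Fintype m] [Fintype k] [Fintype l] (A : Matrix m k ℝ)
    (B : Matrix k l ℝ) : frob (A * B) ≤ frob A * frob B :=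
  frob_mul_le_of A B _ (frob_nonneg' A) (enorm_mulVec_le_frob A)

lemma frob_attnC_le {n D d : ℕ} (WQ U : Matrix (Fin D) (Fin d) ℝ)
    (X : Matrix (Fin n) (Fin D) ℝ) :
    frob (attnC WQ U X) ≤ frob X ^ 2 * (sigmaMax WQ * frob U) := by
  have h1 : frob (X * WQ * (X * U)ᵀ) ≤ frob X ^ 2 * (sigmaMax WQ * frob U) := by
    rw [Matrix.transpose_mul, Matrix.mul_assoc, ← Matrix.mul_assoc WQ]
    calc frob (X * (WQ * Uᵀ * Xᵀ)) ≤ frob X * frob (WQ * Uᵀ * Xᵀ) := frob_mul_le _ _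
      _ ≤ frob X * (frob (WQ * Uᵀ) * frob Xᵀ) := by
          gcongr
          · exact frob_nonneg' _
          · exact frob_mul_le _ _
      _ ≤ frob X * ((sigmaMax WQ * frob Uᵀ) * frob Xᵀ) := by
          gcongr
          · exact frob_nonneg' _
          · exact frob_nonneg' _
          · exact frob_mul_le_of _ _ _ (sigmaMax_nonneg' _) (enorm_mulVec_le_sigmaMax _)
      _ = _ := by rw [frob_transpose', frob_transpose']; ring
  refine le_trans ?_ h1
  refine le_of_sq_le_sq ?_ (frob_nonneg' _)
  rw [frob_sq', frob_sq']
  refine Finset.sum_le_sum fun i _ => Finset.sum_le_sum fun j _ => ?_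
  unfold attnC
  rw [Matrix.smul_apply, smul_eq_mul, mul_pow]
  have h0 : ((Real.sqrt (d : ℝ))⁻¹) ^ 2 ≤ 1 := by
    rw [inv_pow, Real.sq_sqrt (Nat.cast_nonneg d)]
    exact Nat.cast_inv_le_one d
  exact mul_le_of_le_one_left (sq_nonneg _) h0

/-- Covariance bound under softmax weights. -/
lemma cov_bound {n : ℕ} (s a c : Fin n → ℝ) (hs : ∀ j, 0 ≤ s j) (hs1 : ∑ j, s j = 1) :
    |∑ j, s j * c j * a j - (∑ j, s j * a j) * ∑ j, s j * c j| ≤ enorm a * enorm c := by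
  set m := ∑ j, s j * a j with hm
  have hle : ∀ j, s j ≤ 1 := fun j => by
    rw [← hs1]; exact Finset.single_le_sum (fun i _ => hs i) (Finset.mem_univ j)
  have e1 : ∑ j, s j * c j * a j - m * ∑ j, s j * c j
      = ∑ j, (Real.sqrt (s j) * (a j - m)) * (Real.sqrt (s j) * c j) := by
    rw [Finset.mul_sum, ← Finset.sum_sub_distrib]
    refine Finset.sum_congr rfl fun j _ => ?_
    have := Real.mul_self_sqrt (hs j)
    linear_combination (-(a j - m) * c j) * this
  rw [e1]
  refine abs_le_of_sq_le_sq ?_ (mul_nonneg (enorm_nonneg' _) (enorm_nonneg' _))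
  refine (Finset.sum_mul_sq_le_sq_mul_sq _ _ _).trans ?_
  rw [mul_pow, enorm_sq', enorm_sq']
  simp only [mul_pow, Real.sq_sqrt (hs _)]
  refine mul_le_mul ?_ ?_ (Finset.sum_nonneg fun j _ => mul_nonneg (hs j) (sq_nonneg _))
    (Finset.sum_nonneg fun j _ => sq_nonneg _)
  · have e2 : ∑ j, s j * (a j - m) ^ 2 = ∑ j, s j * a j ^ 2 - m ^ 2 := by
      have : ∀ j, s j * (a j - m) ^ 2 = s j * a j ^ 2 - 2 * m * (s j * a j) + m ^ 2 * s j :=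
        fun j => by ring
      simp only [this]
      rw [Finset.sum_add_distrib, Finset.sum_sub_distrib, ← Finset.mul_sum, ← Finset.mul_sum,
        hs1, ← hm]
      ring
    rw [e2]
    have : ∑ j, s j * a j ^ 2 ≤ ∑ j, a j ^ 2 :=
      Finset.sum_le_sum fun j _ => mul_le_of_le_one_left (sq_nonneg _) (hle j)
    linarith [sq_nonneg m]
  · exact Finset.sum_le_sum fun j _ => mul_le_of_le_one_left (sq_nonneg _) (hle j)

/-- Derivative of a softmax average along a line of logits, with its bound. -/
lemma softmax_line {n : ℕ} [NeZero n] (c e a : Fin n → ℝ) :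
    ∃ g : ℝ, |g| ≤ enorm a * enorm e ∧
      HasDerivAt (fun t : ℝ => ∑ j, Real.exp (c j + t * e j) /
        (∑ l, Real.exp (c l + t * e l)) * a j) g 0 := by
  set Z := ∑ l, Real.exp (c l) with hZ
  have hZpos : 0 < Z := Finset.sum_pos (fun l _ => Real.exp_pos _) Finset.univ_nonempty
  refine ⟨_, cov_bound (fun j => Real.exp (c j) / Z) a e (fun j => by positivity) ?_, ?_⟩
  · rw [← Finset.sum_div, div_self hZpos.ne']
  · have hE : ∀ j, HasDerivAt (fun t : ℝ => Real.exp (c j + t * e j)) (Real.exp (c j) * e j) 0 := by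
      intro j
      have := (((hasDerivAt_id (0 : ℝ)).mul_const (e j)).const_add (c j)).exp
      simpa using this
    have hD : HasDerivAt (fun t : ℝ => ∑ l, Real.exp (c l + t * e l))
        (∑ l, Real.exp (c l) * e l) 0 := HasDerivAt.fun_sum fun l _ => hE l
    have hD0 : (∑ l, Real.exp (c l + 0 * e l)) = Z := by simp [hZ]
    have := HasDerivAt.fun_sum (u := Finset.univ) fun j (_ : j ∈ Finset.univ) =>
      ((hE j).fun_div hD (by rw [hD0]; exact hZpos.ne')).mul_const (a j)
    refine this.congr_deriv ?_
    rw [hD0]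
    have hT : ∑ j, Real.exp (c j) / Z * e j = (∑ l, Real.exp (c l) * e l) / Z := by
      rw [Finset.sum_div]
      exact Finset.sum_congr rfl fun j _ => by ring
    rw [hT, Finset.sum_mul, ← Finset.sum_sub_distrib]
    refine Finset.sum_congr rfl fun j _ => ?_
    rw [zero_mul, add_zero]
    field_simp

lemma MH_eq {n D d H : ℕ} (S : Fin H → Matrix (Fin n) (Fin n) ℝ)
    (WV : Fin H → Matrix (Fin D) (Fin d) ℝ) (WO : Fin H → Fin d → ℝ)
    (Xi : Matrix (Fin n) (Fin D) ℝ) (k : Fin n) :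
    MH S WV WO Xi k = ∑ h, ∑ j, S h k j * (Xi *ᵥ (WV h *ᵥ WO h)) j := by
  unfold MH
  refine Finset.sum_congr rfl fun h _ => ?_
  change ((S h * Xi * WV h) *ᵥ WO h) k = (S h *ᵥ (Xi *ᵥ (WV h *ᵥ WO h))) k
  simp only [Matrix.mulVec_mulVec, Matrix.mul_assoc]

lemma attnC_line {n D d H : ℕ} (WQ : Matrix (Fin D) (Fin d) ℝ) (Xi : Matrix (Fin n) (Fin D) ℝ)
    (v u : EuclideanSpace ℝ (Fin H × Fin D × Fin d)) (t : ℝ) (h : Fin H) (k j : Fin n) :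
    attnC WQ (headMat (v + t • u) h) Xi k j
      = attnC WQ (headMat v h) Xi k j + t * attnC WQ (headMat u h) Xi k j := by
  have : headMat (v + t • u) h = headMat v h + t • headMat u h := by
    ext p q
    simp [headMat]
  rw [this]
  unfold attnC
  simp [Matrix.mul_add, Matrix.transpose_add]
  ring

lemma sum_frob_headMat {D d H : ℕ} (u : EuclideanSpace ℝ (Fin H × Fin D × Fin d)) :
    ∑ h, frob (headMat u h) ^ 2 = ‖u‖ ^ 2 := by
  rw [EuclideanSpace.norm_sq_eq, Fintype.sum_prod_type]
  refine Finset.sum_congr rfl fun h _ => ?_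
  rw [frob_sq', Fintype.sum_prod_type]
  simp [headMat]

lemma enorm_head_le {D d H : ℕ} (WV : Fin H → Matrix (Fin D) (Fin d) ℝ) (WO : Fin H → Fin d → ℝ)
    (h : Fin H) : enorm (WV h *ᵥ WO h) ≤ sigmaMax (diagWV WV) * WOnorm WO := by
  refine le_trans ?_ (enorm_mulVec_le_sigmaMax (diagWV WV) (fun hl => WO hl.1 hl.2))
  refine le_of_sq_le_sq ?_ (enorm_nonneg' _)
  rw [enorm_sq', enorm_sq', Fintype.sum_prod_type]
  have : ∀ h' p, (diagWV WV *ᵥ fun hl => WO hl.1 hl.2) (h', p) = (WV h' *ᵥ WO h') p := by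
    intro h' p
    simp [Matrix.mulVec, dotProduct, diagWV, Fintype.sum_prod_type, Finset.sum_ite_irrel]
  simp only [this]
  exact Finset.single_le_sum (f := fun h' => ∑ p, (WV h' *ᵥ WO h') p ^ 2)
    (fun i _ => Finset.sum_nonneg fun _ _ => sq_nonneg _) (Finset.mem_univ h)

/-- Derivative of the loss along a line, with its bound. -/
lemma line_bound {n D d H : ℕ}
    (Xi : Matrix (Fin n) (Fin D) ℝ) (yi : Fin n → ℝ)
    (WQ WV : Fin H → Matrix (Fin D) (Fin d) ℝ) (WO : Fin H → Fin d → ℝ)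
    (v u : EuclideanSpace ℝ (Fin H × Fin D × Fin d)) :
    ∃ g : ℝ, HasDerivAt (fun t : ℝ => (1 / 2) * ∑ k,
        (MH (fun h => Ssoft (WQ h) (headMat (v + t • u) h) Xi) WV WO Xi k - yi k) ^ 2) g 0 ∧
      |g| ≤ (frob Xi ^ 3 * WOnorm WO *
            Real.sqrt (∑ h, sigmaMax (WQ h) ^ 2) * sigmaMax (diagWV WV)) *
          enorm (fun k => MH (fun h => Ssoft (WQ h) (headMat v h) Xi) WV WO Xi k - yi k) * ‖u‖ := by
  set r : Fin n → ℝ := fun k => MH (fun h => Ssoft (WQ h) (headMat v h) Xi) WV WO Xi k - yi k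
    with hr
  have hG : ∀ (h : Fin H) (k : Fin n), ∃ g : ℝ,
      |g| ≤ enorm (Xi *ᵥ (WV h *ᵥ WO h)) * enorm (attnC (WQ h) (headMat u h) Xi k) ∧
      HasDerivAt (fun t : ℝ => ∑ j, Ssoft (WQ h) (headMat (v + t • u) h) Xi k j *
        (Xi *ᵥ (WV h *ᵥ WO h)) j) g 0 := by
    intro h k
    have : NeZero n := ⟨fun h0 => by subst h0; exact k.elim0⟩
    obtain ⟨g, hg1, hg2⟩ := softmax_line (attnC (WQ h) (headMat v h) Xi k)
      (attnC (WQ h) (headMat u h) Xi k) (Xi *ᵥ (WV h *ᵥ WO h))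
    refine ⟨g, hg1, ?_⟩
    simp only [Ssoft, softmaxMat, Matrix.of_apply, attnC_line]
    exact hg2
  choose G hGb hGd using hG
  refine ⟨∑ k, r k * ∑ h, G h k, ?_, ?_⟩
  · have h1 : ∀ k, HasDerivAt (fun t : ℝ =>
        MH (fun h => Ssoft (WQ h) (headMat (v + t • u) h) Xi) WV WO Xi k - yi k)
        (∑ h, G h k) 0 := by
      intro k
      simp only [MH_eq]
      exact (HasDerivAt.fun_sum fun h _ => hGd h k).sub_const _
    have h2 := (HasDerivAt.fun_sum (u := Finset.univ)
      fun k (_ : k ∈ Finset.univ) => (h1 k).fun_pow 2).const_mul (1 / 2 : ℝ)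
    refine h2.congr_deriv ?_
    rw [Finset.mul_sum]
    refine Finset.sum_congr rfl fun k _ => ?_
    simp only [hr, zero_smul, add_zero]
    push_cast
    ring
  · set A : ℝ := frob Xi * (sigmaMax (diagWV WV) * WOnorm WO) with hA
    have hA0 : 0 ≤ A := mul_nonneg (frob_nonneg' _)
      (mul_nonneg (sigmaMax_nonneg' _) (enorm_nonneg' _))
    have ha : ∀ h, enorm (Xi *ᵥ (WV h *ᵥ WO h)) ≤ A := fun h =>
      (enorm_mulVec_le_frob _ _).trans
        (mul_le_mul_of_nonneg_left (enorm_head_le WV WO h) (frob_nonneg' _))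
    have hk : ∀ h, ∑ k, |r k| * enorm (attnC (WQ h) (headMat u h) Xi k)
        ≤ enorm r * frob (attnC (WQ h) (headMat u h) Xi) := by
      intro h
      refine le_of_sq_le_sq ?_ (mul_nonneg (enorm_nonneg' _) (frob_nonneg' _))
      refine (Finset.sum_mul_sq_le_sq_mul_sq _ _ _).trans ?_
      rw [mul_pow, enorm_sq', frob_sq']
      simp only [sq_abs, enorm_sq', le_refl]
    have hs : ∑ h, sigmaMax (WQ h) * frob (headMat u h)
        ≤ Real.sqrt (∑ h, sigmaMax (WQ h) ^ 2) * ‖u‖ := by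
      refine le_of_sq_le_sq ?_ (mul_nonneg (Real.sqrt_nonneg _) (norm_nonneg _))
      refine (Finset.sum_mul_sq_le_sq_mul_sq _ _ _).trans ?_
      rw [mul_pow, Real.sq_sqrt (Finset.sum_nonneg fun _ _ => sq_nonneg _), sum_frob_headMat]
    calc |∑ k, r k * ∑ h, G h k| ≤ ∑ k, ∑ h, |r k| * (A * enorm (attnC (WQ h) (headMat u h) Xi k)) := by
          refine (Finset.abs_sum_le_sum_abs _ _).trans (Finset.sum_le_sum fun k _ => ?_)
          rw [abs_mul, ← Finset.mul_sum]
          refine mul_le_mul_of_nonneg_left ?_ (abs_nonneg _)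
          refine (Finset.abs_sum_le_sum_abs _ _).trans (Finset.sum_le_sum fun h _ => ?_)
          exact (hGb h k).trans (mul_le_mul_of_nonneg_right (ha h) (enorm_nonneg' _))
      _ = A * ∑ h, ∑ k, |r k| * enorm (attnC (WQ h) (headMat u h) Xi k) := by
          rw [Finset.sum_comm, Finset.mul_sum]
          refine Finset.sum_congr rfl fun h _ => ?_
          rw [Finset.mul_sum]
          exact Finset.sum_congr rfl fun k _ => by ring
      _ ≤ A * ∑ h, enorm r * (frob Xi ^ 2 * (sigmaMax (WQ h) * frob (headMat u h))) := by
          refine mul_le_mul_of_nonneg_left (Finset.sum_le_sum fun h _ => (hk h).trans ?_) hA0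
          exact mul_le_mul_of_nonneg_left (frob_attnC_le _ _ _) (enorm_nonneg' _)
      _ = A * (enorm r * frob Xi ^ 2) * ∑ h, sigmaMax (WQ h) * frob (headMat u h) := by
          rw [Finset.mul_sum, Finset.mul_sum]
          exact Finset.sum_congr rfl fun h _ => by ring
      _ ≤ A * (enorm r * frob Xi ^ 2) * (Real.sqrt (∑ h, sigmaMax (WQ h) ^ 2) * ‖u‖) :=
          mul_le_mul_of_nonneg_left hs (mul_nonneg hA0
            (mul_nonneg (enorm_nonneg' _) (sq_nonneg _)))
      _ = _ := by rw [hA]; ring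

/-- Lemma 2(5) of the paper. Per-sample key-gradient bound for the
Softmax-attention Transformer:
`‖∇_{W^K} f(M;X_i)‖_F ≤ K_i ‖MH(M;X_i) − y_i‖₂` with
`K_i = n √H ‖X_i‖_F³ ‖W^O‖₂ √(Σ_h σ_max²(W^Q_h)) σ_max(W^V)`. -/
theorem softmax_per_sample_key_gradient_bound
    {n D d H : ℕ}
    (Xi : Matrix (Fin n) (Fin D) ℝ) (yi : Fin n → ℝ)
    (WQ WV : Fin H → Matrix (Fin D) (Fin d) ℝ) (WO : Fin H → Fin d → ℝ)
    (f : EuclideanSpace ℝ (Fin H × Fin D × Fin d) → ℝ)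
    (hf : f = fun v =>
      (1 / 2) * ∑ k, (MH (fun h => Ssoft (WQ h) (headMat v h) Xi) WV WO Xi k - yi k) ^ 2) :
    ∀ v : EuclideanSpace ℝ (Fin H × Fin D × Fin d),
      ‖gradient f v‖ ≤
        (n * Real.sqrt (H : ℝ) * frob Xi ^ 3 * WOnorm WO *
            Real.sqrt (∑ h, sigmaMax (WQ h) ^ 2) * sigmaMax (diagWV WV)) *
          enorm (fun k => MH (fun h => Ssoft (WQ h) (headMat v h) Xi) WV WO Xi k - yi k) := by
  intro v
  set E := enorm (fun k => MH (fun h => Ssoft (WQ h) (headMat v h) Xi) WV WO Xi k - yi k) with hE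
  have hE0 : 0 ≤ E := enorm_nonneg' _
  have hF0 := frob_nonneg' Xi
  have hW0 : 0 ≤ WOnorm WO := enorm_nonneg' _
  have hV0 := sigmaMax_nonneg' (diagWV WV)
  have hS0 := Real.sqrt_nonneg (∑ h, sigmaMax (WQ h) ^ 2)
  set B : ℝ := frob Xi ^ 3 * WOnorm WO *
    Real.sqrt (∑ h, sigmaMax (WQ h) ^ 2) * sigmaMax (diagWV WV) with hB
  have hB0 : 0 ≤ B := by positivity
  have hrhs : (n * Real.sqrt (H : ℝ) * frob Xi ^ 3 * WOnorm WO *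
            Real.sqrt (∑ h, sigmaMax (WQ h) ^ 2) * sigmaMax (diagWV WV)) * E
      = (n * Real.sqrt (H : ℝ)) * (B * E) := by rw [hB]; ring
  rw [hrhs]
  have key : ‖gradient f v‖ ≤ B * E := by
    by_cases hd : DifferentiableAt ℝ f v
    · set u := gradient f v with hu
      obtain ⟨g, hg, hgb⟩ := line_bound Xi yi WQ WV WO v u
      have h1 : HasDerivAt (fun t : ℝ => f (v + t • u)) (fderiv ℝ f v u) 0 :=
        hd.hasFDerivAt.hasLineDerivAt u
      have h2 : HasDerivAt (fun t : ℝ => f (v + t • u)) g 0 := by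
        rw [hf]; exact hg
      have h3 : fderiv ℝ f v u = g := h1.unique h2
      have h4 : fderiv ℝ f v u = ‖u‖ ^ 2 := by
        rw [← real_inner_self_eq_norm_sq, hu, gradient, InnerProductSpace.toDual_symm_apply]
      have h5 : ‖u‖ ^ 2 ≤ B * E * ‖u‖ := by
        rw [← h4, h3]; exact (le_abs_self g).trans hgb
      rcases (norm_nonneg u).eq_or_lt with h0 | h0
      · rw [← h0]; positivity
      · rw [sq] at h5
        exact le_of_mul_le_mul_right h5 h0
    · rw [gradient_eq_zero_of_not_differentiableAt hd, norm_zero]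
      positivity
  rcases Nat.eq_zero_or_pos n with hn | hn
  · have hB00 : B = 0 := by
      have : frob Xi = 0 := by
        subst hn
        simp [frob]
      rw [hB, this]; ring
    rw [hB00] at key ⊢
    simpa using key
  rcases Nat.eq_zero_or_pos H with hH | hH
  · have hB00 : B = 0 := by
      have : ∑ h, sigmaMax (WQ h) ^ 2 = 0 := by
        subst hH
        simp
      rw [hB, this]; simp
    rw [hB00] at key ⊢
    simpa using key
  · have h1 : (1 : ℝ) ≤ n := by exact_mod_cast hn
    have h2 : (1 : ℝ) ≤ Real.sqrt (H : ℝ) := by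
      rw [Real.one_le_sqrt]; exact_mod_cast hH
    exact key.trans (le_mul_of_one_le_left (by positivity) (one_le_mul_of_one_le_of_one_le h1 h2))

end Paper
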